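/- arXiv:2104.04401 — 2 statements merged into one kernel-verified Lean document; each statement's English description precedes it below -/
import Mathlib

section
/- Fix σ ∈ ℝ and β > 0. Let w be a positive first eigenfunction of the one-dimensional Hermite–Robin problem −w'' + t w' = λ₁(σ) w on I_σ = (−∞,σ), w'(σ) + β w(σ) = 0, with w ∈ H¹(I_σ,φ₁), and set β(t) = −w'(t)/w(t). Then lim_{t → −∞} β(t) = 0 and lim_{t → −∞} β'(t) = 0. -/
open MeasureTheory Real Set Filter Topology
open scoped RealInnerProductSpace NNReal ENNReal

noncomputable section

/-- The density `φ_N` of the standard Gaussian measure on `ℝ^N`. -/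
def gaussDensity (N : ℕ) (x : EuclideanSpace ℝ (Fin N)) : ℝ :=
  (2 * π) ^ (-(N : ℝ) / 2) * Real.exp (-‖x‖ ^ 2 / 2)

/-- The Gaussian measure `γ_N(A) = ∫_A φ_N dx`. -/
def gaussVol (N : ℕ) (A : Set (EuclideanSpace ℝ (Fin N))) : ℝ :=
  ∫ x in A, gaussDensity N x

/-- The `(N-1)`-dimensional Hausdorff measure on `ℝ^N`. -/
def hsurf (N : ℕ) : Measure (EuclideanSpace ℝ (Fin N)) :=
  Measure.hausdorffMeasure ((N : ℝ) - 1)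

/-- Membership in the weighted Sobolev space `H¹(Ω, φ_N)`:
`u` is differentiable in `Ω` and both `u` and `|∇u|` belong to `L²(Ω, φ_N)`. -/
def MemH1 (N : ℕ) (Ω : Set (EuclideanSpace ℝ (Fin N))) (u : EuclideanSpace ℝ (Fin N) → ℝ) : Prop :=
  (∀ x ∈ Ω, DifferentiableAt ℝ u x) ∧
    IntegrableOn (fun x => (u x) ^ 2 * gaussDensity N x) Ω volume ∧
    IntegrableOn (fun x => ‖gradient u x‖ ^ 2 * gaussDensity N x) Ω volume

/-- The Rayleigh quotient `J[β, v]` for the Robin problem for the Hermite operator. -/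
def rayleighQuot (N : ℕ) (Ω : Set (EuclideanSpace ℝ (Fin N))) (β : ℝ)
    (v : EuclideanSpace ℝ (Fin N) → ℝ) : ℝ :=
  ((∫ x in Ω, ‖gradient v x‖ ^ 2 * gaussDensity N x) +
      β * ∫ x in frontier Ω, (v x) ^ 2 * gaussDensity N x ∂(hsurf N)) /
    ∫ x in Ω, (v x) ^ 2 * gaussDensity N x

/-- The first Robin eigenvalue `λ₁(Ω)`, defined as the infimum of the Rayleigh quotient
over nonzero elements of `H¹(Ω, φ_N)`. -/
def lambda1 (N : ℕ) (Ω : Set (EuclideanSpace ℝ (Fin N))) (β : ℝ) : ℝ :=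
  sInf (rayleighQuot N Ω β ''
    {v | MemH1 N Ω v ∧ 0 < ∫ x in Ω, (v x) ^ 2 * gaussDensity N x})

/-- `Ω` is a Lipschitz domain: it is open, connected, and near every boundary point,
in a suitable direction `v`, `Ω` is the subgraph of a Lipschitz function. -/
def IsLipschitzDomain (N : ℕ) (Ω : Set (EuclideanSpace ℝ (Fin N))) : Prop :=
  IsOpen Ω ∧ IsConnected Ω ∧
    ∀ x ∈ frontier Ω, ∃ U : Set (EuclideanSpace ℝ (Fin N)), x ∈ U ∧ IsOpen U ∧
      ∃ (v : EuclideanSpace ℝ (Fin N)) (f : EuclideanSpace ℝ (Fin N) → ℝ) (K : ℝ≥0),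
        ‖v‖ = 1 ∧ LipschitzWith K f ∧
        Ω ∩ U = {y ∈ U | ⟪y, v⟫ < f (y - ⟪y, v⟫ • v)}

/-- `H¹(Ω, φ_N)` is compactly embedded in `L²(Ω, φ_N)`: every sequence bounded in the
`H¹(Ω,φ_N)` norm has a subsequence converging in `L²(Ω, φ_N)`. -/
def H1CompactlyEmbeddedInL2 (N : ℕ) (Ω : Set (EuclideanSpace ℝ (Fin N))) : Prop :=
  ∀ u : ℕ → EuclideanSpace ℝ (Fin N) → ℝ, (∀ n, MemH1 N Ω (u n)) →
    (∃ C : ℝ, ∀ n,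
      (∫ x in Ω, (u n x) ^ 2 * gaussDensity N x) +
        (∫ x in Ω, ‖gradient (u n) x‖ ^ 2 * gaussDensity N x) ≤ C) →
    ∃ (g : ℕ → ℕ) (v : EuclideanSpace ℝ (Fin N) → ℝ), StrictMono g ∧
      Tendsto (fun k => ∫ x in Ω, (u (g k) x - v x) ^ 2 * gaussDensity N x) atTop (𝓝 0)

/-- The trace operator `H¹(Ω,φ_N) → L²(∂Ω, φ_N)` is well defined. -/
def TraceWellDefined (N : ℕ) (Ω : Set (EuclideanSpace ℝ (Fin N))) : Prop :=
  ∀ u, MemH1 N Ω u →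
    IntegrableOn (fun x => (u x) ^ 2 * gaussDensity N x) (frontier Ω) (hsurf N)

/-- The trace operator `H¹(Ω,φ_N) → L²(∂Ω, φ_N)` is compact. -/
def TraceCompact (N : ℕ) (Ω : Set (EuclideanSpace ℝ (Fin N))) : Prop :=
  ∀ u : ℕ → EuclideanSpace ℝ (Fin N) → ℝ, (∀ n, MemH1 N Ω (u n)) →
    (∃ C : ℝ, ∀ n,
      (∫ x in Ω, (u n x) ^ 2 * gaussDensity N x) +
        (∫ x in Ω, ‖gradient (u n) x‖ ^ 2 * gaussDensity N x) ≤ C) →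
    ∃ (g : ℕ → ℕ) (v : EuclideanSpace ℝ (Fin N) → ℝ), StrictMono g ∧
      Tendsto (fun k => ∫ x in frontier Ω, (u (g k) x - v x) ^ 2 * gaussDensity N x ∂(hsurf N))
        atTop (𝓝 0)

/-- The class `𝒢` of admissible domains: Lipschitz domains with Gaussian measure in `(0,1)`
such that `H¹(Ω,φ_N)` is compactly embedded in `L²(Ω, φ_N)` and the trace operator into
`L²(∂Ω, φ_N)` is well defined and compact. -/
def GoodDomain (N : ℕ) (Ω : Set (EuclideanSpace ℝ (Fin N))) : Prop :=
  IsLipschitzDomain N Ω ∧ gaussVol N Ω ∈ Ioo (0 : ℝ) 1 ∧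
    H1CompactlyEmbeddedInL2 N Ω ∧ TraceWellDefined N Ω ∧ TraceCompact N Ω

/-- The half-space `S_a = {x ∈ ℝ^N : x₁ < a}`. -/
def halfSpace (N : ℕ) (hN : 0 < N) (a : ℝ) : Set (EuclideanSpace ℝ (Fin N)) :=
  {x | x ⟨0, hN⟩ < a}

/-- `u` is a (weak) eigenfunction of the Robin problem for the Hermite operator with
eigenvalue `lam`. -/
def IsEigenpair (N : ℕ) (Ω : Set (EuclideanSpace ℝ (Fin N))) (β lam : ℝ)
    (u : EuclideanSpace ℝ (Fin N) → ℝ) : Prop :=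
  MemH1 N Ω u ∧ (0 < ∫ x in Ω, (u x) ^ 2 * gaussDensity N x) ∧
    ∀ ψ, MemH1 N Ω ψ →
      (∫ x in Ω, ⟪gradient u x, gradient ψ x⟫ * gaussDensity N x) +
          β * (∫ x in frontier Ω, u x * ψ x * gaussDensity N x ∂(hsurf N)) =
        lam * ∫ x in Ω, u x * ψ x * gaussDensity N x

/-! ### One-dimensional objects -/

/-- Membership in the one-dimensional weighted Sobolev space `H¹(I_σ, φ₁)`. -/
def MemH1D (σ : ℝ) (v : ℝ → ℝ) : Prop :=
  ContinuousOn v (Iic σ) ∧ (∀ t ∈ Iio σ, DifferentiableAt ℝ v t) ∧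
    IntegrableOn (fun t => (v t) ^ 2 * Real.exp (-t ^ 2 / 2)) (Iio σ) volume ∧
    IntegrableOn (fun t => (deriv v t) ^ 2 * Real.exp (-t ^ 2 / 2)) (Iio σ) volume

/-- The one-dimensional Rayleigh quotient. -/
def rayleighQuot1D (σ β : ℝ) (v : ℝ → ℝ) : ℝ :=
  ((∫ t in Iio σ, (deriv v t) ^ 2 * Real.exp (-t ^ 2 / 2)) +
      β * (v σ) ^ 2 * Real.exp (-σ ^ 2 / 2)) /
    ∫ t in Iio σ, (v t) ^ 2 * Real.exp (-t ^ 2 / 2)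

/-- The first eigenvalue `λ₁(σ)` of the one-dimensional Hermite–Robin problem on
`I_σ = (-∞, σ)`. -/
def lambda1D (σ β : ℝ) : ℝ :=
  sInf (rayleighQuot1D σ β ''
    {v | MemH1D σ v ∧ 0 < ∫ t in Iio σ, (v t) ^ 2 * Real.exp (-t ^ 2 / 2)})

/-- `w` is a positive first eigenfunction of the one-dimensional Hermite–Robin problem
`-w'' + t w' = λ₁(σ) w` on `I_σ`, `w'(σ) + β w(σ) = 0`. -/
def Is1DFirstEigenfunction (σ β : ℝ) (w : ℝ → ℝ) : Prop :=
  MemH1D σ w ∧ (∀ t ∈ Iio σ, 0 < w t) ∧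
    (∀ t ∈ Iio σ, -(deriv (deriv w) t) + t * deriv w t = lambda1D σ β * w t) ∧
    deriv w σ + β * w σ = 0

/-! ### Level sets and the Bossel functional -/

/-- The super-level set `U_t = {x ∈ Ω : u(x) > t}`. -/
def superLevel (N : ℕ) (Ω : Set (EuclideanSpace ℝ (Fin N)))
    (u : EuclideanSpace ℝ (Fin N) → ℝ) (t : ℝ) : Set (EuclideanSpace ℝ (Fin N)) :=
  {x ∈ Ω | t < u x}

/-- The functional `F_Ω(U_t, ψ)`. -/
def Ffun (N : ℕ) (Ω : Set (EuclideanSpace ℝ (Fin N))) (β : ℝ)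
    (u : EuclideanSpace ℝ (Fin N) → ℝ) (t : ℝ) (ψ : EuclideanSpace ℝ (Fin N) → ℝ) : ℝ :=
  (gaussVol N (superLevel N Ω u t))⁻¹ *
    (-(∫ x in superLevel N Ω u t, (ψ x) ^ 2 * gaussDensity N x) +
      (∫ x in {x ∈ Ω | u x = t}, ψ x * gaussDensity N x ∂(hsurf N)) +
      β * (∫ x in {x ∈ frontier Ω | t < u x}, gaussDensity N x ∂(hsurf N)))

/-- A function whose derivative is at least `c` on `[a, ∞)` grows at least linearly. -/
theorem add_mul_sub_le_of_le_hasDerivAt {f : ℝ → ℝ} {a c : ℝ}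
    (hf : ∀ s, a ≤ s → ∃ d, HasDerivAt f d s ∧ c ≤ d) {s : ℝ} (hs : a ≤ s) :
    f a + c * (s - a) ≤ f s := by
  choose! f' hf' hc using hf
  rcases hs.eq_or_lt with rfl | h
  · simp
  · obtain ⟨x, hx, hxs⟩ := exists_hasDerivAt_eq_slope f f' h
      (fun x hx => (hf' x hx.1).continuousAt.continuousWithinAt)
      (fun x hx => hf' x hx.1.le)
    have h1 := hc x hx.1.le
    rw [hxs, le_div_iff₀ (sub_pos.2 h)] at h1
    linarith

/-- A function whose derivative is bounded below by `c > 0` on `[a, ∞)` is unbounded above. -/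
theorem exists_lt_of_le_hasDerivAt {f : ℝ → ℝ} {a c : ℝ} (hc : 0 < c)
    (hf : ∀ s, a ≤ s → ∃ d, HasDerivAt f d s ∧ c ≤ d) (M : ℝ) : ∃ s, a ≤ s ∧ M < f s := by
  have hs : a ≤ a + (|M - f a| + 1) / c := by
    have : 0 ≤ (|M - f a| + 1) / c := by positivity
    linarith
  refine ⟨_, hs, lt_of_lt_of_le ?_ (add_mul_sub_le_of_le_hasDerivAt hf hs)⟩
  have : c * (a + (|M - f a| + 1) / c - a) = |M - f a| + 1 := by field_simp; ring
  rw [this]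
  linarith [le_abs_self (M - f a)]

/-- A barrier principle for a (possibly discontinuous) derivative `q = L'`: if `q` starts above
`b`, is differentiable wherever it is at least `b`, and is strictly increasing whenever it
equals `b`, then it stays above `b`. -/
theorem le_of_hasDerivAt_barrier {L q : ℝ → ℝ} {a b : ℝ}
    (hL : ∀ s, a ≤ s → HasDerivAt L (q s) s) (ha : b ≤ q a)
    (hq : ∀ s, a ≤ s → b ≤ q s → ∃ d, HasDerivAt q d s ∧ (q s = b → 0 < d)) :
    ∀ s, a ≤ s → b ≤ q s := by
  by_contra! hcon
  set B : Set ℝ := {s | a ≤ s ∧ q s < b} with hB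
  have hne : B.Nonempty := hcon
  have hbdd : BddBelow B := ⟨a, fun s hs => hs.1⟩
  set x := sInf B with hx
  have hax : a ≤ x := le_csInf hne fun s hs => hs.1
  have hbelow : ∀ s, a ≤ s → s < x → b ≤ q s := by
    intro s hs hsx
    by_contra! h
    exact absurd (csInf_le hbdd (show s ∈ B from ⟨hs, h⟩)) (not_le.2 hsx)
  have hbx : b ≤ q x := by
    rcases hax.eq_or_lt with h | h
    · rwa [← h]
    · have ht : Tendsto (slope L x) (𝓝[<] x) (𝓝 (q x)) :=
        (hasDerivAt_iff_tendsto_slope.1 (hL x hax)).mono_left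
          (nhdsWithin_mono _ fun y hy => ne_of_lt hy)
      refine ge_of_tendsto ht ?_
      filter_upwards [Ioo_mem_nhdsLT h] with y hy
      obtain ⟨z, hz, hzs⟩ := exists_hasDerivAt_eq_slope L q hy.2
        (fun z hz => (hL z (hy.1.le.trans hz.1)).continuousAt.continuousWithinAt)
        (fun z hz => hL z (hy.1.le.trans hz.1.le))
      rw [slope_comm, slope_def_field, ← hzs]
      exact hbelow z (hy.1.le.trans hz.1.le) hz.2
  obtain ⟨d, hd, hpos⟩ := hq x hax hbx
  have hright : ∀ᶠ y in 𝓝[>] x, b ≤ q y := by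
    rcases hbx.eq_or_lt with h | h
    · have ht : Tendsto (slope q x) (𝓝[>] x) (𝓝 d) :=
        (hasDerivAt_iff_tendsto_slope.1 hd).mono_left
          (nhdsWithin_mono _ fun y hy => ne_of_gt hy)
      filter_upwards [ht.eventually (lt_mem_nhds (hpos h.symm)), self_mem_nhdsWithin] with y hy hxy
      rw [slope_def_field] at hy
      have := (div_pos_iff_of_pos_right (sub_pos.2 hxy)).1 hy
      linarith
    · exact (hd.continuousAt.eventually (lt_mem_nhds h)).filter_mono nhdsWithin_le_nhds |>.mono
        fun y hy => le_of_lt hy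
  obtain ⟨e, he, hsub⟩ := mem_nhdsGT_iff_exists_Ioo_subset.1 hright
  obtain ⟨y, hy, hye⟩ := exists_lt_of_csInf_lt hne (show sInf B < e from he)
  have hxy : x ≤ y := csInf_le hbdd hy
  rcases hxy.eq_or_lt with h | h
  · rw [h] at hbx
    exact absurd hy.2 (not_lt.2 hbx)
  · exact absurd hy.2 (not_lt.2 (hsub ⟨h, hye⟩))

section Riccati

/- Asymptotics of global solutions of the Riccati equation `q' = s q - l - q²`, where `q = L'` and
the equation is only required where `s q ≠ l`. -/

variable {L q : ℝ → ℝ} {l S : ℝ}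

/-- A global solution of the Riccati equation is nonnegative. -/
theorem riccati_nonneg (hl : 0 ≤ l) (hS : 0 < S)
    (hL : ∀ s, S ≤ s → HasDerivAt L (q s) s)
    (hq : ∀ s, S ≤ s → s * q s ≠ l → HasDerivAt q (s * q s - l - q s ^ 2) s)
    {a : ℝ} (ha : S ≤ a) : 0 ≤ q a := by
  by_contra! hneg
  have hode : ∀ s, a ≤ s → q s < 0 → HasDerivAt q (s * q s - l - q s ^ 2) s := by
    intro s hs h
    refine hq s (ha.trans hs) (ne_of_lt ?_)
    have : s * q s < 0 := mul_neg_of_pos_of_neg (by linarith) h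
    linarith
  have hbar : ∀ s, a ≤ s → -q a ≤ -q s := by
    refine le_of_hasDerivAt_barrier (L := fun s => -L s) (q := fun s => -q s)
      (fun s hs => (hL s (ha.trans hs)).neg) le_rfl ?_
    intro s hs h
    have h0 : q s < 0 := by linarith
    refine ⟨_, (hode s hs h0).neg, fun _ => ?_⟩
    have : s * q s < 0 := mul_neg_of_pos_of_neg (by linarith) h0
    nlinarith [sq_nonneg (q s)]
  have hqneg : ∀ s, a ≤ s → q s < 0 := fun s hs => by linarith [hbar s hs]
  obtain ⟨s, hs, hpos⟩ := exists_lt_of_le_hasDerivAt (f := fun s => (q s)⁻¹) (a := a) one_pos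
    (by
      intro s hs
      have h0 := hqneg s hs
      refine ⟨_, (hode s hs h0).inv h0.ne, ?_⟩
      have : s * q s < 0 := mul_neg_of_pos_of_neg (by linarith) h0
      rw [le_div_iff₀ (sq_pos_of_neg h0)]
      linarith) 0
  exact absurd hpos (not_lt.2 (inv_nonpos.2 (hqneg s hs).le))

/-- Lower asymptotic bound `s q(s) ≥ l - ε` for global solutions of the Riccati equation. -/
theorem riccati_lower (hl : 0 ≤ l) (hS : 0 < S)
    (hL : ∀ s, S ≤ s → HasDerivAt L (q s) s)
    (hq : ∀ s, S ≤ s → s * q s ≠ l → HasDerivAt q (s * q s - l - q s ^ 2) s)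
    {ε : ℝ} (hε : 0 < ε) : ∀ᶠ s in atTop, l - ε ≤ s * q s := by
  have hlarge : ∀ᶠ a : ℝ in atTop, l < ε * a := by
    have : Tendsto (fun a : ℝ => ε * a) atTop atTop := tendsto_id.const_mul_atTop hε
    exact this.eventually_gt_atTop l
  filter_upwards [eventually_ge_atTop S, eventually_ge_atTop 1, hlarge] with a ha ha1 hla
  by_contra! hlt
  have hode : ∀ s, a ≤ s → s * q s ≤ l - ε → HasDerivAt q (s * q s - l - q s ^ 2) s :=
    fun s hs h => hq s (ha.trans hs) (by linarith)
  have hiff : ∀ s, a ≤ s → 0 ≤ (l - ε) / s - q s → s * q s ≤ l - ε := by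
    intro s hs h
    have h' : q s ≤ (l - ε) / s := by linarith
    rwa [le_div_iff₀ (by linarith), mul_comm] at h'
  have hbar : ∀ s, a ≤ s → 0 ≤ (l - ε) / s - q s := by
    refine le_of_hasDerivAt_barrier (L := fun s => (l - ε) * Real.log s - L s)
      (q := fun s => (l - ε) / s - q s) ?_ ?_ ?_
    · intro s hs
      have := ((Real.hasDerivAt_log (x := s) (by linarith)).const_mul (l - ε)).sub
        (hL s (ha.trans hs))
      exact this.congr_deriv (by rw [div_eq_mul_inv])
    · rw [sub_nonneg, le_div_iff₀ (by linarith), mul_comm]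
      exact hlt.le
    · intro s hs h
      have hs0 : s ≠ 0 := by linarith
      have hd := ((hasDerivAt_inv hs0).const_mul (l - ε)).sub (hode s hs (hiff s hs h))
      refine ⟨_, hd, fun h0 => ?_⟩
      have hsq : s * q s = l - ε := by
        have : q s = (l - ε) / s := by linarith
        rw [this]; field_simp
      rw [hsq]
      have h1 : (l - ε) * -(s ^ 2)⁻¹ > -ε := by
        have h2 : (l - ε) * (s ^ 2)⁻¹ < ε := by
          rw [← div_eq_mul_inv, div_lt_iff₀ (by positivity)]
          nlinarith [mul_le_mul_of_nonneg_left hs hε.le]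
        linarith
      nlinarith [sq_nonneg (q s)]
  obtain ⟨s, hs, hpos⟩ := exists_lt_of_le_hasDerivAt (f := fun s => -q s) (a := a) hε
    (by
      intro s hs
      have h0 := hiff s hs (hbar s hs)
      exact ⟨_, (hode s hs h0).neg, by nlinarith [sq_nonneg (q s)]⟩) 0
  linarith [riccati_nonneg hl hS hL hq (ha.trans hs)]

/-- Upper asymptotic bound `s q(s) ≤ l + ε` for those solutions of the Riccati equation for which
`exp (2 L(s) - s² / 2)` is not eventually bounded below by a positive value. -/
theorem riccati_upper (hl : 0 ≤ l) (hS : 0 < S)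
    (hL : ∀ s, S ≤ s → HasDerivAt L (q s) s)
    (hq : ∀ s, S ≤ s → s * q s ≠ l → HasDerivAt q (s * q s - l - q s ^ 2) s)
    (hgrowth : ∀ a, S ≤ a → ∃ s, a ≤ s ∧ L s - s ^ 2 / 4 < L a - a ^ 2 / 4)
    {ε : ℝ} (hε : 0 < ε) : ∀ᶠ s in atTop, s * q s ≤ l + ε := by
  have hlarge : ∀ᶠ a : ℝ in atTop, ((l + ε) / a) ^ 2 < ε := by
    have : Tendsto (fun a : ℝ => ((l + ε) / a) ^ 2) atTop (𝓝 (0 ^ 2)) :=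
      (tendsto_const_nhds.div_atTop tendsto_id).pow 2
    exact this.eventually (gt_mem_nhds (by simpa using hε))
  filter_upwards [eventually_ge_atTop S, hlarge] with a ha hsmall
  by_contra! hlt
  have ha0 : 0 < a := by linarith
  set δ := (l + ε) / a with hδ
  have hδ0 : 0 < δ := by positivity
  have haδ : a * δ = l + ε := by rw [hδ]; field_simp
  have hode' : ∀ s, a ≤ s → δ ≤ q s → HasDerivAt q (s * q s - l - q s ^ 2) s := by
    intro s hs h
    refine hq s (ha.trans hs) (ne_of_gt ?_)
    have : a * δ ≤ s * q s := mul_le_mul hs h hδ0.le (by linarith)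
    linarith
  have hbar : ∀ s, a ≤ s → δ ≤ q s := by
    refine le_of_hasDerivAt_barrier (fun s hs => hL s (ha.trans hs)) ?_ ?_
    · rw [hδ, div_le_iff₀ ha0]
      linarith
    · intro s hs h
      refine ⟨_, hode' s hs h, fun h0 => ?_⟩
      rw [h0]
      nlinarith [mul_le_mul_of_nonneg_right hs hδ0.le]
  have hode := fun s hs => hode' s hs (hbar s hs)
  have hev : ∀ᶠ s : ℝ in atTop, l + 1 + δ ^ 2 ≤ δ * s := by
    have : Tendsto (fun s : ℝ => δ * s) atTop atTop := tendsto_id.const_mul_atTop hδ0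
    exact this.eventually_ge_atTop _
  obtain ⟨b, hb⟩ := (hev.and ((eventually_ge_atTop a).and
    (eventually_ge_atTop (2 * δ)))).exists_forall_of_atTop
  have hba : a ≤ b := (hb b le_rfl).2.1
  have hexists : ∃ c, b ≤ c ∧ 0 ≤ q c - c / 2 := by
    by_contra! hno
    obtain ⟨s, hs, hpos⟩ := exists_lt_of_le_hasDerivAt (f := fun s => q s - s / 2) (a := b)
      one_half_pos
      (by
        intro s hs
        refine ⟨_, (hode s (hba.trans hs)).sub ((hasDerivAt_id s).div_const 2), ?_⟩
        have h1 := hno s hs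
        obtain ⟨h2, -, h3⟩ := hb s hs
        have h4 := hbar s (hba.trans hs)
        nlinarith [mul_nonneg (sub_nonneg.2 h4) (show 0 ≤ s - q s - δ by linarith)]) 0
    linarith [hno s hs]
  obtain ⟨c, hbc, hc⟩ := hexists
  have hLd : ∀ s, c ≤ s → HasDerivAt (fun s => L s - s ^ 2 / 4) (q s - s / 2) s := by
    intro s hs
    have := (hL s (ha.trans (hba.trans (hbc.trans hs)))).sub
      (((hasDerivAt_id s).pow 2).div_const 4)
    exact this.congr_deriv (by simp; ring)
  have hbar2 : ∀ s, c ≤ s → 0 ≤ q s - s / 2 := by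
    refine le_of_hasDerivAt_barrier hLd hc ?_
    intro s hs h
    refine ⟨_, (hode s (hba.trans (hbc.trans hs))).sub ((hasDerivAt_id s).div_const 2),
      fun h0 => ?_⟩
    have h1 : q s = s / 2 := by linarith
    obtain ⟨h2, -, h3⟩ := hb s (hbc.trans hs)
    rw [h1]
    nlinarith [mul_nonneg (show 0 ≤ s / 2 - δ by linarith) (show 0 ≤ s / 2 - δ by linarith)]
  obtain ⟨s, hs, hlt'⟩ := hgrowth c (ha.trans (hba.trans hbc))
  have := add_mul_sub_le_of_le_hasDerivAt (f := fun s => L s - s ^ 2 / 4) (c := 0)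
    (fun s hs => ⟨_, hLd s hs, hbar2 s hs⟩) hs
  linarith

end Riccati

/-- The one-dimensional Robin eigenvalue is nonnegative. -/
theorem lambda1D_nonneg (σ : ℝ) {β : ℝ} (hβ : 0 ≤ β) : 0 ≤ lambda1D σ β := by
  refine Real.sInf_nonneg ?_
  rintro _ ⟨v, -, rfl⟩
  unfold rayleighQuot1D
  have h1 : 0 ≤ ∫ t in Iio σ, (deriv v t) ^ 2 * Real.exp (-t ^ 2 / 2) :=
    integral_nonneg fun t => by positivity
  have h2 : 0 ≤ ∫ t in Iio σ, (v t) ^ 2 * Real.exp (-t ^ 2 / 2) :=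
    integral_nonneg fun t => by positivity
  positivity

/-- For a positive first eigenfunction `w`, the product `t β(t) = -t w'(t) / w(t)` tends to
`-λ₁(σ)` as `t → -∞`. -/
theorem Is1DFirstEigenfunction.tendsto_mul_betaFun {σ β : ℝ} {w : ℝ → ℝ} (hβ : 0 ≤ β)
    (hw : Is1DFirstEigenfunction σ β w) :
    Tendsto (fun t => t * (-deriv w t / w t)) atBot (𝓝 (-lambda1D σ β)) := by
  obtain ⟨⟨-, hdiff, hint, -⟩, hpos, hode, -⟩ := hw
  have hl := lambda1D_nonneg σ hβ
  set l := lambda1D σ β with hldef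
  set S : ℝ := |σ| + 1 with hSdef
  have hS : 0 < S := by positivity
  have hmem : ∀ s, S ≤ s → -s ∈ Iio σ := by
    intro s hs
    simp only [mem_Iio]
    linarith [neg_abs_le σ]
  set L : ℝ → ℝ := fun s => Real.log (w (-s)) with hLdef
  set q : ℝ → ℝ := fun s => -deriv w (-s) / w (-s) with hqdef
  have hwd : ∀ s, S ≤ s → HasDerivAt (fun s => w (-s)) (-deriv w (-s)) s := by
    intro s hs
    have := (hdiff _ (hmem s hs)).hasDerivAt.comp s (hasDerivAt_neg s)
    simpa [Function.comp_def] using this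
  have hL : ∀ s, S ≤ s → HasDerivAt L (q s) s := fun s hs =>
    (hwd s hs).log (hpos _ (hmem s hs)).ne'
  have hq : ∀ s, S ≤ s → s * q s ≠ l → HasDerivAt q (s * q s - l - q s ^ 2) s := by
    intro s hs hne
    have hw0 := (hpos _ (hmem s hs)).ne'
    have ho := hode _ (hmem s hs)
    by_cases hd : DifferentiableAt ℝ (deriv w) (-s)
    · have h1 := hd.hasDerivAt.comp s (hasDerivAt_neg s)
      have h2 := h1.neg.div (hwd s hs) hw0
      refine HasDerivAt.congr_deriv (f := q) h2 ?_
      have h3 : deriv (deriv w) (-s) = -s * deriv w (-s) - l * w (-s) := by linarith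
      simp only [hqdef, Function.comp_apply, Pi.neg_apply, h3]
      field_simp
    · refine absurd ?_ hne
      rw [deriv_zero_of_not_differentiableAt hd] at ho
      simp only [hqdef]
      field_simp
      linarith
  have hgrowth : ∀ a, S ≤ a → ∃ s, a ≤ s ∧ L s - s ^ 2 / 4 < L a - a ^ 2 / 4 := by
    intro a ha
    by_contra! hno
    have hsub : Iic (-a) ⊆ Iio σ := Iic_subset_Iio.2 (hmem a ha)
    have hconst : IntegrableOn (fun _ : ℝ => Real.exp (2 * (L a - a ^ 2 / 4))) (Iic (-a)) := by
      refine Integrable.mono' (hint.mono_set hsub) aestronglyMeasurable_const ?_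
      filter_upwards [ae_restrict_mem measurableSet_Iic] with t ht
      have ht' : a ≤ -t := by linarith [show t ≤ -a from ht]
      have h1 := hno (-t) ht'
      have hwt : 0 < w t := hpos t (hsub ht)
      rw [Real.norm_of_nonneg (Real.exp_pos _).le]
      calc Real.exp (2 * (L a - a ^ 2 / 4))
          ≤ Real.exp (2 * (L (-t) - (-t) ^ 2 / 4)) := by gcongr
        _ = w t ^ 2 * Real.exp (-t ^ 2 / 2) := by
          have : 2 * (L (-t) - (-t) ^ 2 / 4) = Real.log (w t) + Real.log (w t) + -t ^ 2 / 2 := by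
            simp only [hLdef, neg_neg]; ring
          rw [this, Real.exp_add, Real.exp_add, Real.exp_log hwt]; ring
    rw [integrableOn_const_iff] at hconst
    simp [Real.exp_ne_zero] at hconst
  have hlim : Tendsto (fun s => s * q s) atTop (𝓝 l) := by
    rw [Metric.tendsto_nhds]
    intro ε hε
    filter_upwards [riccati_lower hl hS hL hq (half_pos hε),
      riccati_upper hl hS hL hq hgrowth (half_pos hε)] with s h1 h2
    rw [Real.dist_eq, abs_lt]
    constructor <;> linarith
  have := (hlim.comp tendsto_neg_atBot_atTop).neg
  refine this.congr fun t => ?_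
  simp [hqdef]

/-- **Limits of `β(t) = -w'/w` and `β'` at `-∞`.** If `w` is a positive first eigenfunction
of the one-dimensional Hermite–Robin problem on `I_σ = (-∞,σ)`, then `β(t) → 0` and
`β'(t) → 0` as `t → -∞`. -/
theorem betaFun_tendsto_zero_atBot (σ β : ℝ) (hβ : 0 < β) (w : ℝ → ℝ)
    (hw : Is1DFirstEigenfunction σ β w) :
    Tendsto (fun t => -deriv w t / w t) atBot (𝓝 0) ∧
      Tendsto (deriv (fun t => -deriv w t / w t)) atBot (𝓝 0) := by
  have hmul := hw.tendsto_mul_betaFun hβ.le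
  have hlim : Tendsto (fun t => -deriv w t / w t) atBot (𝓝 0) := by
    refine (hmul.div_atBot tendsto_id).congr' ?_
    filter_upwards [eventually_lt_atBot 0] with t ht
    have : t ≠ 0 := ht.ne
    simp only [id]
    field_simp
  refine ⟨hlim, ?_⟩
  have hbound : Tendsto (fun t => (-deriv w t / w t) ^ 2 + t * (-deriv w t / w t) + lambda1D σ β)
      atBot (𝓝 0) := by
    have := ((hlim.pow 2).add hmul).add_const (lambda1D σ β)
    simpa using this
  obtain ⟨⟨-, hdiff, -, -⟩, hpos, hode, -⟩ := hw
  refine squeeze_zero_norm' ?_ (by simpa only [norm_zero] using hbound.norm)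
  filter_upwards [eventually_lt_atBot σ] with t ht
  have hw0 := (hpos t ht).ne'
  by_cases hd : DifferentiableAt ℝ (deriv w) t
  · have h1 := hd.hasDerivAt.neg.div (hdiff t ht).hasDerivAt hw0
    refine le_of_eq (congrArg _ (h1.deriv.trans ?_))
    have h3 : deriv (deriv w) t = t * deriv w t - lambda1D σ β * w t := by linarith [hode t ht]
    simp only [Pi.neg_apply, h3]
    field_simp
    ring
  · have hnd : ¬ DifferentiableAt ℝ (fun t => -deriv w t / w t) t := by
      intro h
      refine hd ((h.mul (hdiff t ht)).neg.congr_of_eventuallyEq ?_)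
      filter_upwards [gt_mem_nhds ht] with x hx
      have := (hpos x hx).ne'
      simp only [Pi.neg_apply, Pi.mul_apply]
      field_simp
    rw [deriv_zero_of_not_differentiableAt hnd, norm_zero]
    exact norm_nonneg _
end
end

section
/- Fix β > 0 and for σ ∈ ℝ let λ₁(σ) denote the first eigenvalue of the one-dimensional Hermite–Robin problem on I_σ = (−∞,σ) with parameter β. Then λ₁ is monotone: for all r, σ ∈ ℝ with r ≤ σ one has λ₁(r) ≥ λ₁(σ). -/
open MeasureTheory Real Set Filter Topology
open scoped RealInnerProductSpace NNReal ENNReal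

noncomputable section

lemma hasDerivAt_sq_mul_gauss {v : ℝ → ℝ} {v' t : ℝ} (hv : HasDerivAt v v' t) :
    HasDerivAt (fun t => (v t) ^ 2 * Real.exp (-t ^ 2 / 2))
      (2 * v t * v' * Real.exp (-t ^ 2 / 2) + (v t) ^ 2 * (Real.exp (-t ^ 2 / 2) * (-t))) t := by
  have h : HasDerivAt (fun t : ℝ => -t ^ 2 / 2) (-t) t :=
    (((hasDerivAt_id' t).fun_pow 2).fun_neg.div_const 2).congr_deriv (by simp; ring)
  exact ((hv.fun_pow 2).fun_mul h.exp).congr_deriv (by simp)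

lemma hasDerivAt_const_mul_exp (β a c t : ℝ) :
    HasDerivAt (fun t => c * Real.exp (-(β * (t - a))))
      (-(β * (c * Real.exp (-(β * (t - a)))))) t :=
  ((((hasDerivAt_id' t).sub_const a).const_mul β).fun_neg.exp.const_mul c).congr_deriv (by ring)

/-- Lower bound for the Robin energy on `(-∞, a)`, obtained by comparison with `e^{-βt}`. -/
lemma robin_energy_lower_bound {β a : ℝ} (hβ : 0 < β) {v : ℝ → ℝ}
    (hv : ∀ t ≤ a, DifferentiableAt ℝ v t)
    (hv2 : IntegrableOn (fun t => (v t) ^ 2 * Real.exp (-t ^ 2 / 2)) (Iio a))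
    (hd2 : IntegrableOn (fun t => (deriv v t) ^ 2 * Real.exp (-t ^ 2 / 2)) (Iio a)) :
    -(β ^ 2 + β * a) * (∫ t in Iio a, (v t) ^ 2 * Real.exp (-t ^ 2 / 2)) ≤
      (∫ t in Iio a, (deriv v t) ^ 2 * Real.exp (-t ^ 2 / 2)) +
        β * (v a) ^ 2 * Real.exp (-a ^ 2 / 2) := by
  rw [← integrableOn_Iic_iff_integrableOn_Iio] at hv2 hd2
  rw [← integral_Iic_eq_integral_Iio, ← integral_Iic_eq_integral_Iio]
  set F : ℝ → ℝ := fun t => (deriv v t) ^ 2 * Real.exp (-t ^ 2 / 2) +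
    (β ^ 2 + β * a) * ((v t) ^ 2 * Real.exp (-t ^ 2 / 2)) with hF
  have hFi : IntegrableOn F (Iic a) := hd2.add (hv2.const_mul _)
  have hint : ∫ t in Iic a, F t = (∫ t in Iic a, (deriv v t) ^ 2 * Real.exp (-t ^ 2 / 2)) +
      (β ^ 2 + β * a) * ∫ t in Iic a, (v t) ^ 2 * Real.exp (-t ^ 2 / 2) := by
    rw [← integral_const_mul]
    exact integral_add hd2 (hv2.const_mul _)
  have hder (t : ℝ) (ht : t ≤ a) :
      HasDerivAt (fun t => -(β * ((v t) ^ 2 * Real.exp (-t ^ 2 / 2))))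
        (-(β * (2 * v t * deriv v t * Real.exp (-t ^ 2 / 2) +
          (v t) ^ 2 * (Real.exp (-t ^ 2 / 2) * (-t))))) t :=
    ((hasDerivAt_sq_mul_gauss (hv t ht).hasDerivAt).const_mul β).neg
  have key (M : ℝ) (hM : M ≤ a) :
      -(β * ((v a) ^ 2 * Real.exp (-a ^ 2 / 2))) ≤ ∫ t in M..a, F t := by
    have h := intervalIntegral.sub_le_integral_of_hasDeriv_right_of_le (φ := F) hM
      (fun t ht => (hder t ht.2).continuousAt.continuousWithinAt)
      (fun t ht => (hder t ht.2.le).hasDerivWithinAt)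
      (hFi.mono_set Icc_subset_Iic_self) (fun t ht => by
        have h1 : 0 ≤ (deriv v t + β * v t) ^ 2 * Real.exp (-t ^ 2 / 2) := by positivity
        have h2 : 0 ≤ β * (a - t) * ((v t) ^ 2 * Real.exp (-t ^ 2 / 2)) :=
          mul_nonneg (mul_nonneg hβ.le (sub_nonneg.2 ht.2.le)) (by positivity)
        simp only [hF]
        linarith)
    have : 0 ≤ β * ((v M) ^ 2 * Real.exp (-M ^ 2 / 2)) := by positivity
    linarith
  have hlim := intervalIntegral_tendsto_integral_Iic a hFi tendsto_id
  have := ge_of_tendsto hlim ((eventually_le_atBot a).mono key)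
  rw [hint] at this
  linarith

lemma rayleighQuot1D_nonneg {β : ℝ} (hβ : 0 < β) (σ : ℝ) (v : ℝ → ℝ) :
    0 ≤ rayleighQuot1D σ β v := by
  unfold rayleighQuot1D
  have h1 : 0 ≤ ∫ t in Iio σ, (deriv v t) ^ 2 * Real.exp (-t ^ 2 / 2) :=
    integral_nonneg fun t => by positivity
  have h2 : 0 ≤ ∫ t in Iio σ, (v t) ^ 2 * Real.exp (-t ^ 2 / 2) :=
    integral_nonneg fun t => by positivity
  positivity

lemma lambda1D_mul_le {β σ : ℝ} (hβ : 0 < β) {v : ℝ → ℝ} (hv : MemH1D σ v)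
    (hpos : 0 < ∫ t in Iio σ, (v t) ^ 2 * Real.exp (-t ^ 2 / 2)) :
    lambda1D σ β * (∫ t in Iio σ, (v t) ^ 2 * Real.exp (-t ^ 2 / 2)) ≤
      (∫ t in Iio σ, (deriv v t) ^ 2 * Real.exp (-t ^ 2 / 2)) +
        β * (v σ) ^ 2 * Real.exp (-σ ^ 2 / 2) := by
  rw [← le_div_iff₀ hpos]
  refine csInf_le ⟨0, ?_⟩ ⟨v, ⟨hv, hpos⟩, rfl⟩
  rintro _ ⟨w, -, rfl⟩
  exact rayleighQuot1D_nonneg hβ σ w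

/-- Testing `lambda1D` with `v` on `(-∞, a]` continued in a `C¹` way by `f` on `[a, σ]`. -/
lemma lambda1D_mul_le_of_glue {β σ a : ℝ} (hβ : 0 < β) (haσ : a < σ) {v f f' : ℝ → ℝ}
    (hv : ∀ t ≤ a, DifferentiableAt ℝ v t)
    (hv2 : IntegrableOn (fun t => (v t) ^ 2 * Real.exp (-t ^ 2 / 2)) (Iio a))
    (hd2 : IntegrableOn (fun t => (deriv v t) ^ 2 * Real.exp (-t ^ 2 / 2)) (Iio a))
    (hpos : 0 < ∫ t in Iio a, (v t) ^ 2 * Real.exp (-t ^ 2 / 2))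
    (hf : ∀ t, HasDerivAt f (f' t) t) (hf' : Continuous f')
    (hfa : f a = v a) (hfa' : f' a = deriv v a) :
    lambda1D σ β * ((∫ t in Iio a, (v t) ^ 2 * Real.exp (-t ^ 2 / 2)) +
        ∫ t in a..σ, (f t) ^ 2 * Real.exp (-t ^ 2 / 2)) ≤
      (∫ t in Iio a, (deriv v t) ^ 2 * Real.exp (-t ^ 2 / 2)) +
        (∫ t in a..σ, (f' t) ^ 2 * Real.exp (-t ^ 2 / 2)) +
        β * (f σ) ^ 2 * Real.exp (-σ ^ 2 / 2) := by
  have hfc : Continuous f := continuous_iff_continuousAt.2 fun t => (hf t).continuousAt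
  set u : ℝ → ℝ := fun t => if t < a then v t else f t with hu
  have hul : ∀ t ∈ Iio a, u t = v t := fun t ht => if_pos ht
  have hur : ∀ t ∈ Ici a, u t = f t := fun t ht => if_neg (not_lt.2 ht)
  have hdl (t : ℝ) (ht : t ∈ Iio a) : HasDerivAt u (deriv v t) t :=
    (hv t (le_of_lt ht)).hasDerivAt.congr_of_eventuallyEq
      (Filter.eventuallyEq_of_mem (Iio_mem_nhds ht) hul)
  have hdr (t : ℝ) (ht : t ∈ Ici a) : HasDerivAt u (f' t) t := by
    rcases eq_or_lt_of_le (show a ≤ t from ht) with rfl | ht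
    · have h1 : HasDerivWithinAt u (f' a) (Iic a) a := by
        rw [hfa']
        refine (hv a le_rfl).hasDerivAt.hasDerivWithinAt.congr_of_mem (fun t ht => ?_) self_mem_Iic
        rcases eq_or_lt_of_le (show t ≤ a from ht) with rfl | ht
        · rw [hur t self_mem_Ici, hfa]
        · exact hul t ht
      have h2 : HasDerivWithinAt u (f' a) (Ici a) a :=
        (hf a).hasDerivWithinAt.congr_of_mem hur self_mem_Ici
      simpa [Iic_union_Ici] using h1.union h2
    · exact (hf t).congr_of_eventuallyEq
        (Filter.eventuallyEq_of_mem (Ioi_mem_nhds ht) fun s hs => hur s (mem_Ici.2 (le_of_lt hs)))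
  have hdiff (t : ℝ) : DifferentiableAt ℝ u t := by
    rcases lt_or_ge t a with ht | ht
    · exact (hdl t ht).differentiableAt
    · exact (hdr t ht).differentiableAt
  have split {g g₁ g₂ : ℝ → ℝ} (h₁ : IntegrableOn g₁ (Iio a)) (h₂ : Continuous g₂)
      (e₁ : ∀ t ∈ Iio a, g t = g₁ t) (e₂ : ∀ t ∈ Ici a, g t = g₂ t) :
      IntegrableOn g (Iio σ) ∧ ∫ t in Iio σ, g t = (∫ t in Iio a, g₁ t) + ∫ t in a..σ, g₂ t := by
    have i₁ : IntegrableOn g (Iio a) := h₁.congr_fun (fun t ht => (e₁ t ht).symm) measurableSet_Iio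
    have i₂ : IntegrableOn g (Ico a σ) :=
      ((h₂.integrableOn_Icc (a := a) (b := σ)).mono_set Ico_subset_Icc_self).congr_fun
        (fun t ht => (e₂ t ht.1).symm) measurableSet_Ico
    rw [← Iio_union_Ico_eq_Iio haσ.le]
    refine ⟨i₁.union i₂, ?_⟩
    have hdisj : Disjoint (Iio a) (Ico a σ) := Set.disjoint_left.2 fun t h1 h2 => not_lt.2 h2.1 h1
    rw [setIntegral_union hdisj measurableSet_Ico i₁ i₂, setIntegral_congr_fun measurableSet_Iio e₁,
      setIntegral_congr_fun measurableSet_Ico fun t ht => e₂ t ht.1,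
      intervalIntegral.integral_of_le haσ.le, integral_Ico_eq_integral_Ioc]
  obtain ⟨iu, eu⟩ := split (g := fun t => (u t) ^ 2 * Real.exp (-t ^ 2 / 2)) hv2
    (g₂ := fun t => (f t) ^ 2 * Real.exp (-t ^ 2 / 2)) (by fun_prop)
    (fun t ht => by simp only [hul t ht]) (fun t ht => by simp only [hur t ht])
  obtain ⟨idu, edu⟩ := split (g := fun t => (deriv u t) ^ 2 * Real.exp (-t ^ 2 / 2)) hd2
    (g₂ := fun t => (f' t) ^ 2 * Real.exp (-t ^ 2 / 2)) (by fun_prop)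
    (fun t ht => by simp only [(hdl t ht).deriv]) (fun t ht => by simp only [(hdr t ht).deriv])
  have hG : 0 ≤ ∫ t in a..σ, (f t) ^ 2 * Real.exp (-t ^ 2 / 2) :=
    intervalIntegral.integral_nonneg haσ.le fun t _ => by positivity
  have h := lambda1D_mul_le (v := u) hβ
    ⟨fun t _ => (hdiff t).continuousAt.continuousWithinAt, fun t _ => hdiff t, iu, idu⟩
    (by rw [eu]; linarith)
  rwa [eu, edu, hur σ haσ.le] at h

/-- The energy on `[a, σ]` of `c e^{-β(t - a)}`, including its boundary term. -/
lemma exp_extension_energy_le {β a σ : ℝ} (hβ : 0 < β) (haσ : a ≤ σ) (c : ℝ) :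
    (∫ t in a..σ, (-(β * (c * Real.exp (-(β * (t - a)))))) ^ 2 * Real.exp (-t ^ 2 / 2)) +
        β * (c * Real.exp (-(β * (σ - a)))) ^ 2 * Real.exp (-σ ^ 2 / 2) ≤
      β * c ^ 2 * Real.exp (-a ^ 2 / 2) + -(β ^ 2 + β * a) *
        ∫ t in a..σ, (c * Real.exp (-(β * (t - a)))) ^ 2 * Real.exp (-t ^ 2 / 2) := by
  set w : ℝ → ℝ := fun t => c * Real.exp (-(β * (t - a))) with hw
  have hwc : Continuous w := by fun_prop
  have hwd (t : ℝ) : HasDerivAt w (-(β * w t)) t :=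
    hasDerivAt_const_mul_exp β a c t
  have hder (t : ℝ) : HasDerivAt (fun t => β * ((w t) ^ 2 * Real.exp (-t ^ 2 / 2)))
      (β * (2 * w t * (-(β * w t)) * Real.exp (-t ^ 2 / 2) +
        (w t) ^ 2 * (Real.exp (-t ^ 2 / 2) * (-t)))) t :=
    (hasDerivAt_sq_mul_gauss (hwd t)).const_mul β
  have hi₁ : Continuous fun t => (-(β * w t)) ^ 2 * Real.exp (-t ^ 2 / 2) := by fun_prop
  have hi₂ : Continuous fun t => -(β ^ 2 + β * a) * ((w t) ^ 2 * Real.exp (-t ^ 2 / 2)) := by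
    fun_prop
  have h := intervalIntegral.sub_le_integral_of_hasDeriv_right_of_le haσ
    (fun t _ => (hder t).continuousAt.continuousWithinAt)
    (fun t _ => (hder t).hasDerivWithinAt)
    ((hi₂.fun_sub hi₁).integrableOn_Icc) (fun t ht => by
      have h2 : 0 ≤ β * (t - a) * ((w t) ^ 2 * Real.exp (-t ^ 2 / 2)) :=
        mul_nonneg (mul_nonneg hβ.le (sub_nonneg.2 ht.1.le)) (by positivity)
      linarith)
  rw [intervalIntegral.integral_sub (hi₂.intervalIntegrable _ _) (hi₁.intervalIntegrable _ _),
    intervalIntegral.integral_const_mul] at h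
  have hwa : w a = c := by simp [hw]
  rw [hwa] at h
  change (∫ t in a..σ, (-(β * w t)) ^ 2 * Real.exp (-t ^ 2 / 2)) +
    β * w σ ^ 2 * Real.exp (-σ ^ 2 / 2) ≤ _ + _ * ∫ t in a..σ, w t ^ 2 * Real.exp (-t ^ 2 / 2)
  linarith

lemma tendsto_intervalIntegral_sq_mul_exp {a σ C : ℝ} (haσ : a ≤ σ) {F : ℕ → ℝ → ℝ} {f : ℝ → ℝ}
    (hF : ∀ n, Continuous (F n)) (hC : ∀ n, ∀ t ∈ Ioc a σ, |F n t| ≤ C)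
    (hlim : ∀ t ∈ Ioc a σ, Tendsto (fun n => F n t) atTop (𝓝 (f t))) :
    Tendsto (fun n => ∫ t in a..σ, (F n t) ^ 2 * Real.exp (-t ^ 2 / 2)) atTop
      (𝓝 (∫ t in a..σ, (f t) ^ 2 * Real.exp (-t ^ 2 / 2))) := by
  refine intervalIntegral.tendsto_integral_filter_of_dominated_convergence (fun _ => C ^ 2)
    (Eventually.of_forall fun n => ?_) (Eventually.of_forall fun n => ?_) (by simp) ?_
  · have := hF n
    exact Continuous.aestronglyMeasurable (by fun_prop)
  · refine Eventually.of_forall fun t ht => ?_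
    rw [uIoc_of_le haσ] at ht
    rw [Real.norm_of_nonneg (by positivity), ← sq_abs]
    have h1 : Real.exp (-t ^ 2 / 2) ≤ 1 := Real.exp_le_one_iff.2 (by nlinarith [sq_nonneg t])
    calc |F n t| ^ 2 * Real.exp (-t ^ 2 / 2) ≤ C ^ 2 * 1 := by
          gcongr
          exact hC n t ht
      _ = C ^ 2 := mul_one _
  · refine Eventually.of_forall fun t ht => ?_
    rw [uIoc_of_le haσ] at ht
    exact ((hlim t ht).pow 2).mul_const _

/-- `lambda1D σ β` bounds from below the Robin quotient on a smaller half-line. -/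
lemma lambda1D_mul_le_of_lt {β σ a : ℝ} (hβ : 0 < β) (haσ : a < σ) {v : ℝ → ℝ}
    (hv : ∀ t ≤ a, DifferentiableAt ℝ v t)
    (hv2 : IntegrableOn (fun t => (v t) ^ 2 * Real.exp (-t ^ 2 / 2)) (Iio a))
    (hd2 : IntegrableOn (fun t => (deriv v t) ^ 2 * Real.exp (-t ^ 2 / 2)) (Iio a)) :
    lambda1D σ β * (∫ t in Iio a, (v t) ^ 2 * Real.exp (-t ^ 2 / 2)) ≤
      (∫ t in Iio a, (deriv v t) ^ 2 * Real.exp (-t ^ 2 / 2)) +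
        β * (v a) ^ 2 * Real.exp (-a ^ 2 / 2) := by
  have hlow := robin_energy_lower_bound hβ hv hv2 hd2
  have hD0 : 0 ≤ ∫ t in Iio a, (v t) ^ 2 * Real.exp (-t ^ 2 / 2) :=
    integral_nonneg fun t => by positivity
  have hN0 : 0 ≤ ∫ t in Iio a, (deriv v t) ^ 2 * Real.exp (-t ^ 2 / 2) :=
    integral_nonneg fun t => by positivity
  rcases hD0.eq_or_lt with hD | hD
  · rw [← hD, mul_zero]
    positivity
  set c := v a with hc
  set q := deriv v a + β * c with hq
  set w : ℝ → ℝ := fun t => c * Real.exp (-(β * (t - a))) with hw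
  set f : ℕ → ℝ → ℝ := fun n t => w t + q * ((t - a) * Real.exp (-(n * (t - a)))) with hf
  set f' : ℕ → ℝ → ℝ := fun n t =>
    -(β * w t) + q * ((1 - n * (t - a)) * Real.exp (-(n * (t - a)))) with hf'
  have hwd (t : ℝ) : HasDerivAt w (-(β * w t)) t :=
    hasDerivAt_const_mul_exp β a c t
  have hfd (n : ℕ) (t : ℝ) : HasDerivAt (f n) (f' n t) t := by
    have h1 := (hasDerivAt_id' t).sub_const a
    exact ((hwd t).fun_add ((h1.fun_mul (h1.const_mul (n : ℝ)).fun_neg.exp).const_mul q)).congr_deriv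
      (by simp only [hf']; ring)
  have hglue (n : ℕ) := lambda1D_mul_le_of_glue hβ haσ hv hv2 hd2 hD (hfd n)
    (by simp only [hf', hw]; fun_prop) (by simp [hf, hw, hc]) (by simp [hf', hw, hq])
  have hwb (t : ℝ) (ht : t ∈ Ioc a σ) : |w t| ≤ |c| := by
    rw [hw, abs_mul, Real.abs_exp]
    exact mul_le_of_le_one_right (abs_nonneg _)
      (Real.exp_le_one_iff.2 (by nlinarith [mul_pos hβ (sub_pos.2 ht.1)]))
  have htop (t : ℝ) (ht : a < t) : Tendsto (fun n : ℕ => (n : ℝ) * (t - a)) atTop atTop :=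
    tendsto_natCast_atTop_atTop.atTop_mul_const (sub_pos.2 ht)
  have hexp (t : ℝ) (ht : a < t) :
      Tendsto (fun n : ℕ => Real.exp (-((n : ℝ) * (t - a)))) atTop (𝓝 0) :=
    Real.tendsto_exp_neg_atTop_nhds_zero.comp (htop t ht)
  have hflim (t : ℝ) (ht : a < t) : Tendsto (fun n => f n t) atTop (𝓝 (w t)) := by
    simpa [hf] using (((hexp t ht).const_mul (t - a)).const_mul q).const_add (w t)
  have hflim' (t : ℝ) (ht : a < t) : Tendsto (fun n => f' n t) atTop (𝓝 (-(β * w t))) := by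
    have h1 : Tendsto (fun n : ℕ => (n : ℝ) * (t - a) * Real.exp (-((n : ℝ) * (t - a)))) atTop
        (𝓝 0) := by
      simpa [Function.comp_def] using (Real.tendsto_pow_mul_exp_neg_atTop_nhds_zero 1).comp (htop t ht)
    have h := (((hexp t ht).sub h1).const_mul q).const_add (-(β * w t))
    simpa [hf', sub_mul] using h
  have T₁ := tendsto_intervalIntegral_sq_mul_exp (C := |c| + |q| * (σ - a)) haσ.le (F := f) (f := w)
    (fun n => by simp only [hf, hw]; fun_prop) (fun n t ht => by
      refine (abs_add_le _ _).trans (add_le_add (hwb t ht) ?_)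
      rw [abs_mul, abs_mul, Real.abs_exp, abs_of_pos (sub_pos.2 ht.1)]
      have h1 : Real.exp (-(n * (t - a))) ≤ 1 := Real.exp_le_one_iff.2
        (neg_nonpos.2 (mul_nonneg n.cast_nonneg (sub_pos.2 ht.1).le))
      have h2 := sub_pos.2 ht.1
      calc |q| * ((t - a) * Real.exp (-(n * (t - a)))) ≤ |q| * ((t - a) * 1) := by gcongr
        _ ≤ |q| * (σ - a) := by
          rw [mul_one]
          gcongr
          exact ht.2)
    (fun t ht => hflim t ht.1)
  have T₂ := tendsto_intervalIntegral_sq_mul_exp (C := β * |c| + |q|) haσ.le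
    (F := f') (f := fun t => -(β * w t))
    (fun n => by simp only [hf', hw]; fun_prop) (fun n t ht => by
      refine (abs_add_le _ _).trans (add_le_add ?_ ?_)
      · rw [abs_neg, abs_mul, abs_of_pos hβ]
        exact mul_le_mul_of_nonneg_left (hwb t ht) hβ.le
      · rw [abs_mul]
        refine mul_le_of_le_one_right (abs_nonneg _) ?_
        have hs : 0 ≤ (n : ℝ) * (t - a) := mul_nonneg n.cast_nonneg (sub_pos.2 ht.1).le
        rw [abs_mul, Real.abs_exp, Real.exp_neg, ← div_eq_mul_inv, div_le_one (Real.exp_pos _)]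
        have := Real.add_one_le_exp ((n : ℝ) * (t - a))
        exact abs_le.2 ⟨by linarith, by linarith⟩)
    (fun t ht => hflim' t ht.1)
  have hlim := le_of_tendsto_of_tendsto'
    ((T₁.const_add (∫ t in Iio a, (v t) ^ 2 * Real.exp (-t ^ 2 / 2))).const_mul (lambda1D σ β))
    ((T₂.const_add (∫ t in Iio a, (deriv v t) ^ 2 * Real.exp (-t ^ 2 / 2))).add
      ((((hflim σ haσ).pow 2).const_mul β).mul_const (Real.exp (-σ ^ 2 / 2)))) hglue
  have hE := exp_extension_energy_le hβ haσ.le c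
  have hG : 0 ≤ ∫ t in a..σ, (w t) ^ 2 * Real.exp (-t ^ 2 / 2) :=
    intervalIntegral.integral_nonneg haσ.le fun t _ => by positivity
  change (∫ t in a..σ, (-(β * w t)) ^ 2 * Real.exp (-t ^ 2 / 2)) +
    β * w σ ^ 2 * Real.exp (-σ ^ 2 / 2) ≤ _ + _ * ∫ t in a..σ, w t ^ 2 * Real.exp (-t ^ 2 / 2) at hE
  generalize (∫ t in a..σ, (w t) ^ 2 * Real.exp (-t ^ 2 / 2)) = G at *
  generalize (∫ t in Iio a, (v t) ^ 2 * Real.exp (-t ^ 2 / 2)) = D at *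
  set N := (∫ t in Iio a, (deriv v t) ^ 2 * Real.exp (-t ^ 2 / 2)) +
    β * c ^ 2 * Real.exp (-a ^ 2 / 2) with hN
  have h1 : lambda1D σ β * (D + G) ≤ N + -(β ^ 2 + β * a) * G := by linarith
  have h2 : lambda1D σ β * D * (D + G) ≤ N * (D + G) := by
    linarith [mul_le_mul_of_nonneg_left h1 hD.le, mul_le_mul_of_nonneg_right hlow hG]
  exact le_of_mul_le_mul_right h2 (by linarith)

lemma memH1D_one (σ : ℝ) : MemH1D σ (fun _ => 1) := by
  have h : Integrable fun t : ℝ => Real.exp (-t ^ 2 / 2) := by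
    convert integrable_exp_neg_mul_sq (b := 1 / 2) (by norm_num) using 2 with t
    congr 1
    ring
  exact ⟨continuousOn_const, fun t _ => differentiableAt_const _, by simpa using h.integrableOn,
    by simp⟩

lemma tendsto_setIntegral_Iio {g : ℝ → ℝ} {r : ℝ} (hg : IntegrableOn g (Iio r))
    {x : ℕ → ℝ} (hx : Monotone x) (hxr : ∀ n, x n < r) (hlim : Tendsto x atTop (𝓝 r)) :
    Tendsto (fun n => ∫ t in Iio (x n), g t) atTop (𝓝 (∫ t in Iio r, g t)) := by
  have hU : ⋃ n, Iio (x n) = Iio r := by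
    ext t
    simp only [mem_iUnion, mem_Iio]
    exact ⟨fun ⟨n, hn⟩ => hn.trans (hxr n), fun ht => (hlim.eventually_const_lt ht).exists⟩
  rw [← hU] at hg ⊢
  exact tendsto_setIntegral_of_monotone (fun _ => measurableSet_Iio)
    (fun m n hmn => Iio_subset_Iio (hx hmn)) hg

/-- **Monotonicity of the first one-dimensional eigenvalue with respect to inclusion of
half-lines.** For `r ≤ σ` one has `λ₁(r) ≥ λ₁(σ)`. -/
theorem lambda1D_antitone (β : ℝ) (hβ : 0 < β) (r σ : ℝ) (hrσ : r ≤ σ) :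
    lambda1D σ β ≤ lambda1D r β := by
  refine le_csInf ⟨_, _, ⟨memH1D_one r, ?_⟩, rfl⟩ ?_
  · have hi := (memH1D_one r).2.2.1
    rw [setIntegral_pos_iff_support_of_nonneg_ae (Eventually.of_forall fun t => by positivity) hi]
    have : Function.support (fun t : ℝ => (1 : ℝ) ^ 2 * Real.exp (-t ^ 2 / 2)) = univ :=
      Set.eq_univ_of_forall fun t => by simp [Real.exp_ne_zero]
    rw [this, univ_inter, Real.volume_Iio]
    exact ENNReal.zero_lt_top
  · rintro _ ⟨v, ⟨⟨hc, hd, hv2, hd2⟩, hpos⟩, rfl⟩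
    rw [rayleighQuot1D, le_div_iff₀ hpos]
    obtain ⟨x, hx, hxr, hlim⟩ := exists_seq_strictMono_tendsto r
    have hvlim : Tendsto (fun n => v (x n)) atTop (𝓝 (v r)) :=
      (hc r self_mem_Iic).tendsto.comp
        (tendsto_nhdsWithin_iff.2 ⟨hlim, Eventually.of_forall fun n => (hxr n).le⟩)
    have hexp : Tendsto (fun n => Real.exp (-(x n) ^ 2 / 2)) atTop (𝓝 (Real.exp (-r ^ 2 / 2))) :=
      (Continuous.tendsto (f := fun t : ℝ => Real.exp (-t ^ 2 / 2)) (by fun_prop) r).comp hlim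
    exact le_of_tendsto_of_tendsto'
      ((tendsto_setIntegral_Iio hv2 hx.monotone hxr hlim).const_mul _)
      ((tendsto_setIntegral_Iio hd2 hx.monotone hxr hlim).add
        (((hvlim.pow 2).const_mul β).mul hexp))
      fun n => lambda1D_mul_le_of_lt hβ ((hxr n).trans_le hrσ)
        (fun t ht => hd t (lt_of_le_of_lt ht (hxr n)))
        (hv2.mono_set (Iio_subset_Iio (hxr n).le)) (hd2.mono_set (Iio_subset_Iio (hxr n).le))
end
end
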